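/- There exists a holey packing quadruple system HPQS(71,23) having exactly J(71,4,4) − J(23,4,4) = 14075 − 419 = 13656 blocks. -/

import Mathlib

/-- A 3-(n,4,1) packing design (packing quadruple system PQS(n)) on the point
set `Fin n`: a collection of 4-element blocks such that every 3-element subset
of points is contained in at most one block. -/
def IsPQS (n : ℕ) (B : Finset (Finset (Fin n))) : Prop :=
  (∀ b ∈ B, b.card = 4) ∧
  ∀ t : Finset (Fin n), t.card = 3 → (B.filter (fun b => t ⊆ b)).card ≤ 1

/-- The packing number A(n,4,4): the maximum number of blocks in a
3-(n,4,1) packing design. -/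
noncomputable def packingNumber (n : ℕ) : ℕ :=
  sSup {N | ∃ B : Finset (Finset (Fin n)), IsPQS n B ∧ B.card = N}

/-- The Johnson bound J(n,4,4). -/
def johnsonBound (n : ℕ) : ℕ :=
  if n % 6 = 0 then n * ((n - 1) * ((n - 2) / 2) / 3) / 4 - 1
  else n * ((n - 1) * ((n - 2) / 2) / 3) / 4

/-- There exists a holey packing quadruple system HPQS(n,m) with exactly `N`
blocks: a PQS(n) together with an m-element hole `Y` such that no 3-element
subset of `Y` is contained in any block. -/
def ExistsHPQS (n m N : ℕ) : Prop :=
  ∃ (B : Finset (Finset (Fin n))) (Y : Finset (Fin n)),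
    IsPQS n B ∧ Y.card = m ∧
    (∀ t : Finset (Fin n), t ⊆ Y → t.card = 3 → ∀ b ∈ B, ¬ t ⊆ b) ∧
    B.card = N

/-! The system is a union of orbits of a group of order 96 acting on the 71 points. The group has four
orbits: the 48 points `0, …, 47` outside the hole, and `{48}`, `{49, …, 64}`, `{65, …, 70}` inside
the hole. Finite functions are stored as natural numbers, seven bits per value, so that the
kernel can compute with them.
-/

namespace HPQS

/-- The `i`-th seven-bit digit of `p`, read as a point. -/
def digit (p i : ℕ) : ℕ := (p >>> (7 * i)) % 128 % 71

/-- Two permutations generating the group. -/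
@[irreducible]
def gens : List ℕ :=
  [222282255815961087955089787187760267913927842346210975440112378437449762064236158640937514468501798523333692577183092888544606210410816604156236873734,
  209469822436640079468706585118896273870805920735841871142775066995689581809941624403375817222557879112631632915463354034076536139724481787986769348128]

/-- All 96 elements of the group. -/
@[irreducible]
def group : List ℕ :=
  [225503511637336514062769260455550009796436009263413749408805389136078905358679646276562308967426390762866821681519944441696107891347690951477441888384,
  225503511637327008331040268097956394855962975413462735351097674800130181850609650563759235157050187256147864602207580775643330737599786075170019988864,
  219135336667388002898508565093964166598816017838669804500829121728695916315707435819349100092759731187765423477627347395061024209682283030412005540609,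
  219135336667389405558158157019825499577597315133803847278227643762111717802214978031197271319265322804845145779575045854632858063586163759493484565633,
  212616741585206639571543746153765362414564789219901303892182799512389915861878655846089103458538721801780111098142839706279991861655428717466588660098,
  212616741585204505010963001067760040748985050165730903658137662334842259517311744775355799802106970383996001075001736046380604442068195997294344720130,
  215837997406579130506095541280412479072032056709831156758673307250836696832203227276811218096417942615957433135547732919738644587946809123158974613635,
  215837997406581373088845173445340908855592737697453297952549558275644640050038434853708745540485702578843567031007376583530420596617402125782140736131,
  215837997406580623621672917129546075230014236377871427764790604009397348331025098345880176158317060391794904097280130962487503288418871939562735748356,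
  215837997406575552653828910339168945795219606357992951912795288144592569288068534737196996444751573632599369348394872922360274016929507677347244557700,
  222282255815963983818678998538702407490122041983315050658716958391857247884170698037677893096656695481151926803112684217916979076190618700756503677573,
  222282255815964670820359321666310082135058123602823573136936691417724608982849780324017232307198325081789014417880064078160318524478100950063340145413,
  222282255815961087955089787187760267913927842346210975440112378437449762064236158640937514468501798523333692577183092888544606210410816604156236873734,
  222282255815962496161083003755706470427652957658858195637829862181142010893066833317879044931844071465209900053340443973207511114039189308274547102598,
  219135336667393016637058503770871682854269089784962759969009685338773117522099400848004278409124658231494081179278969397435226229717767239484974597127,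
  219135336667394504473120826217817404324565403819473390052901593150226693308123815364243109755122747375314231081346303120839697886058242092437185465223,
  222282255815960321052347075315113068827369014793951942759484694108408044093791825116292761742837928925328524099919178534397594299321878192380451147016,
  222282255815965414293729218585347033696734780757476046631163187472319356944170547414245079715066315960394998506083371696112298615586645401175461549960,
  225503511637334259240072012258547462199424387634754244827775705926464069580555160040356508029100179058821864748674609442190394009189786898309428005257,
  225503511637335026399985191503756408025302439600006891581081862400831533248927267856096802584753287397018528707251010581989934201439197512236345641481,
  209469822436641584206930871203015499023083848524326634695302940584925500703955352489779641402747557118773072027086084892139022557009154843293711454602,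
  209469822436642282433442173462293958645354002323613282930054534812769870099051907303040130953146684652890486585584670971325129079255760008970510684682,
  209469822436635723983787655657610924006561763446398139243469162099791833156820564153446690422715256069907771975507333270445076604209308159779097268619,
  209469822436633572079822304839603285167990292599101537625829383650502540940000783659323002041198456572879758855021710919664550925167000164613568696843,
  212616741585212431609207232431317889664805318177978842248622723215870915939399566396703517225441421885224914552478388456145474808899995876297688796556,
  212616741585203760782389968011336148565325863294895065687302584879007973775089282472725731642470738200691415458915481857949240461224096245973129055756,
  209469822436634310095199778432956454277938652921573606503025271033915568600204255406718270092066171478178589800971227479648583173402822838312585774989,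
  209469822436632793558900490793165176164819963203756071824775962164963841904465058640590115419386275309193852774857691551069647365598387958755847456781,
  209469822436636422119467309167224426000959617008473911341425112771270290424422174639942775442625102313962837671345298645014501203939512395279433975694,
  209469822436639381064397841035243107748889868286746611508865155511067882569862866216945051606462922056016514020861645499755467953308338867979986241550,
  212616741585208836988841488531754048317936243817607787028325704251591592239130319903750027839713223136517279660571652765409924222766802786126373030159,
  212616741585207338412190511784418884701295788847350071942373363892876725143052283645277006060718180505519207731096357055674127778520693064760882959119,
  212616741585211034583633373819267153929338700209535039554886170866390611398525192776132769929236567636559740620847977645006387022696382437203578112272,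
  212616741585205152084829723248001152169615114509775241642846651051091754498816019399712135446808713999065596889334656484210904779977262296557865259792,
  209469822436637234353322981327187853371893147740182380454887304283128974498003294375989767519309883034710082461427929983418361521697616655852394381585,
  209469822436640862736438935985156839203497705810849687639593062345522088038709767605965911222620617214956305501739353807944490076971874166382434193041,
  215837997406576932822602723544109605577349301487358117538322774963991719502300719115538081583987188012489316667004870574858720497887786982140847441554,
  215837997406583479917492337347571722898113745131394144385730104858962449837985509859769537961327167661777988300693438458693892964580956970494951048978,
  219135336667391608212354740786287166619654228852472128897232258522373604279231893462054120494431833074153607168348646713469199871797712277903803714707,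
  219135336667392301596764085691476563759398979343572734439437930998192612330663159172319308904069144371779097086246616082929883158929217082965147194899,
  219135336667386560132235527666537513976972226738940313166905353496363828546510965090753728933068570568128135219415461954688007772746564308079915535508,
  219135336667390841930698224106893105546779440402485704385184869096717446482708405815892867608187626994650355118657986845004821569170666009709951358484,
  225503511637329909917400944543228218648369633234834653239971545037945319023629942027186035543862012290508578440790387101621527339292406416335786432149,
  225503511637330682139556433089010607282122467695345211896994502496780574815809109895042083119339563256251573547241674544929386813383370277068906632981,
  225503511637325582997927764210084464746133629852657221039688320192045150054926376154941609413377400678248070206734540950829155269978374705402435851926,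
  225503511637329222517845226849283308953673738459216723985969544995918329415829902239855196982309434633442363693387208599990433484436552696818290972438,
  222282255815955204746482676590185125297995571562486117953664491932746302555942048644138175345401601787164836733079558363140924032811750901657695915287,
  222282255815955971290205216203309988901012199621910892277171044523579797647492688025360574194748362711485409811195879589683067708967382260086232078231,
  225503511637335792676835564058179127046447155318198373081894146925121803899929950189808129944855106303193950896563428027267280329023455196474644056472,
  225503511637328450161918939328268860443068607472326494205983688996134363078695739129015449047064810178650391708779676118420552329766934953760678677016,
  222282255815959577227888236825438526949630220153944317270598613002549197559755927430283453773851157556914879698523590841621345211502945827134261167257,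
  222282255815954483986508822228969727303650970279042543555887434709626961559640174533120278692784861897777623626963297890015555122497280320986065095705,
  225503511637333566379748600945472017479803434482218802686248779418629779566244805481149087944638426198538343857279053519644064581894868362168858297242,
  225503511637327746211572306514412434891400450098317383811504690840445063029264193204422350299727489958952050867383906649031777323749789325977943315738,
  215837997406579902195898744392897676419895795853130021854981820495128020939514426560977610591135979749784330347605385268962707592353929941527571337243,
  215837997406582043183129579830030881972371627711775975279708314245332246290834796850037267741038679248250606226726972275242583100028980024850071523483,
  215837997406576245378681583221665236220773659624789316698986118976920058561034092029825970735017182546600761449724684843748970955361441098092564041756,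
  215837997406578397810805121959454304911925511735888266040587985114883262959790398628749706261664345966037889569982973322314000132100483194103311782044,
  212616741585203056968632622814318084094151152193897365502886264323850178217921338793360419149236064169013218245550790226794615267672710703486259757469,
  212616741585209530023886246134924452013643220051190113419658011255544874015931993339511256186579106015351572439983429336400983831717346063696930770717,
  215837997406572605947451642867748879556000279990535769810321441481684882963665413605218943221280801302692381837862132186653014525483020837001850128542,
  215837997406573383407859980515678112663017922643571492312457745503050895972713965431350337565728624767686451540109377175516252574927562752948257362590,
  212616741585205918761640386694615993846093604698079664437392116770109678723353019015447266862939916466706258144647212782114849535297338560552295370143,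
  212616741585211716039974308208161850277729890566670084105352911377805011407478706335453419208533812876760101367194932250367394095676404217587406229023,
  209469822436640079468706585118896273870805920735841871142775066995689581809941624403375817222557879112631632915463354034076536139724481787986769348128,
  209469822436632072709833174219546471027285869802785025392383985217143090631446283288931044361484719435008165900869578708766056992269217300428634853280,
  209469822436631374038998825800379133127748104248846356142390237262891954845069017885180622852070914547093963123775877296852361517511035792416288704033,
  209469822436637938389246449819071897684150549792556576357023354110722479848775115708220750998142437465947520612852069900419210012844909115199237476257,
  215837997406577688098155010637270116973689056480559842842045519715203517275153118939024785366638338165164776794314372904775919475016803155150377190690,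
  215837997406574070807764968456718662588093021411643927946108827301457117991253389645251027385276082530277871464656502181143624136523460739192966546850,
  212616741585202290336187361006394654973396705221215882481904902105324496921259002055739586624205017517204532642844554724827110385260819779115528012323,
  212616741585208116050740066126211562388787016345410863618419016482388059150744417902485951207206620722763785359992231351667835501172994381544302530851,
  212616741585201546330161623868174944895331216673706224433163601933184680136809253248790322296831382508994430076916983317548327286623237819162656670244,
  212616741585210313734219767207996133778060444037144867776063616470074328394449179570562287696182491056755584791772949760050593069717848969704267338020,
  209469822436638620248669655527230554515704384632661734529336993130482576525465038140883359804295441454174849103106102514103196725483938050532666851621,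
  209469822436635003134371047852253031269277011869235460472130363087088512306460931805024741718345910971766865943109763694347467981817021843753847393957,
  215837997406574802921181951019425587020197671200939222300108135414557916860382040604887215523078925209622824183953199562108186723717563546617388861094,
  215837997406582815138407485946464604469678800692577364337443433938093219159265469382694282238310316678243425111116349285612527813192033204207897118502,
  225503511637326326565200098779549006599185648725897410969432351112410214764947369908063474306145659448460519779313581653180106453429885532990758715559,
  225503511637331420554856139952161388698365739508777634384408150891371251501203032181262337667945019865061768759778319226406239104693064671752970900903,
  222282255815963250946937108497509586256602472415987672623724333177474915064644314604747613259501365684726365955413968456987388834395310331052874238632,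
  222282255815957447902107875914119996947666025353156062715162232891562601180252735077306598997331708545886776215107577753112335447347583603433854749480,
  222282255815961820028265194235667718768024679571988155627658107973292404235052319517758205963551704416770022983671402593972637040065159409931389141033,
  222282255815956738187748855092616657327877266202295243483441163977191813771522745272195919784621499855347307040805603329637925360548459595101680980905,
  219135336667387241718212308346219200180905327592886619590355587742596291056645082585382213096403780538016135716182663576002474611260414517146672366634,
  219135336667393771645781946938136776142627624956856318122333101412457325380690360118958651332445711890505328669408207130712404791686696114493684485034,
  219135336667388735060409402021766185890587720382904104507764612113535497429058956218940524057431370301138809543797723088771166247576535485280233243435,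
  219135336667384363067391777331070711592746981934073450351759973742386602462147636665533327993705200644276669475220175469468462213532359120154031396011,
  222282255815958923893679971343769561448933747142159728615754309681511598679037949449444427808368407927362407181040886449626605080655368886112661816492,
  222282255815958157349960160404409863069303635171357284484675811513751292704258689502032040896099188722052875880174401116639431626817039840172539284524,
  219135336667385810624491483007338200974660554158107030414509258286496232649361023182108117396937426292341429393423076296643834547497259996414097146541,
  219135336667390166242511800875428731690571018890596875103642204746612443432503877610623461251989919104100132538806631210290950379693135258842615059501,
  219135336667385072740146981125929405881381555128065497397310818790994300416710718149485180575960273237932967324197531882454507246373825208568185979566,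
  219135336667395214455721845517790295476928648576040453259207154362947206176972567645576811655626309002911211764465792795929876898649285457039379715118,
  225503511637332828451001083839101777364933828215728312463038623049417649878705904662257606232719531616681500244459215209951783774262585339171077424047,
  225503511637332073264173932785460039175836316719009922765397316857495889089719854227829845021976146948632308980358394039743769363988145969872368833839]

/-- Representatives of the block orbits; the four points of a block are its first four digits. -/
@[irreducible]
def baseBlocks : List ℕ :=
  [100696192, 8437888, 29442176, 111247488, 84000896, 37879936, 90325120, 79855744, 134398080,
  113442944, 42156160, 35897472, 52691072, 61128832, 124076160, 103121024, 140886144, 119931008,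
  88506496, 67551360, 73859200, 99057792, 117948544, 143147136, 136872064, 147406976, 95010944,
  128598144, 97190016, 122454144, 109887616, 145604736, 131006592, 139444352, 42008832, 25248000,
  46252288, 142737664, 31604992, 92438784, 138625280, 40075520, 52723968, 107299072, 103137536,
  61210880, 65437952, 147243264, 76038400, 113803520, 97042688, 145326336, 120176896, 128581888,
  130793728, 109871360, 137232640, 126779648, 141476096, 135250176, 134332800, 37896576, 94552448,
  40059264, 136561024, 63259008, 80085376, 99123584, 126615936, 107757952, 132940160, 116195712,
  124649856, 33686016, 121831936, 113541632, 126206464, 71729664, 116032000, 137036288, 111936000,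
  139215360, 124568064, 118292992, 147735040, 143606272, 135234048, 50463360, 134365824, 144966272,
  103072384, 92701312, 111690368, 120095360, 99222144, 105644672, 114082432, 147653248, 139313792,
  143524480, 128877184, 133087872, 111313792, 128123776, 100909952, 88474496, 124142464, 120013696,
  103334784, 116081536, 130843520, 122471296, 147686272, 143590272, 137347968, 144868352,
  111346688, 105595904, 134972416, 103547904, 137151488, 139363328, 128910336, 117621888, 75695232,
  98911360, 54887552, 82183296, 145491072, 111953024, 147866752, 141591680, 54707456, 50545920,
  121865472, 117802240, 135120128, 141444352, 147834112, 82019712, 69600640, 111756672, 128730496,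
  139265408, 143492480, 137266560, 141493632, 147817856, 130926592, 137250816, 133072896,
  147851264, 71649536, 118229248, 135219456, 50694784, 120343168, 132975232, 139479680, 145803904,
  147917440, 137104128, 143690496, 147901184, 139201536, 126667776, 143674368, 147934208,
  147590400, 114052352, 135040256, 132992256, 145771776, 143707392, 143397760, 118248320,
  112006016, 141579136, 145789824, 141301632, 120362880, 135059328, 147888000, 145823616]

/-- The map on points with values stored in `p`. -/
def act (p : ℕ) (i : Fin 71) : Fin 71 := ⟨digit p i, Nat.mod_lt _ (by decide)⟩

/-- The translate by `e` of the base block `b`. -/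
def translate (e b : ℕ) : Finset (Fin 71) :=
  Finset.univ.image fun j : Fin 4 => act e (act b (j.castLE (by decide)))

/-- The blocks of the system. -/
@[irreducible]
def blocks : Finset (Finset (Fin 71)) :=
  (group.flatMap fun e => baseBlocks.map (translate e)).toFinset

/-- The bit mask of `translate e b`. -/
def mask (e b : ℕ) : ℕ :=
  1 <<< digit e (digit b 0) ||| 1 <<< digit e (digit b 1) |||
    1 <<< digit e (digit b 2) ||| 1 <<< digit e (digit b 3)

/-- The bit of `m` at `a`, in a form that the kernel evaluates quickly. -/
def hasBit (m a : ℕ) : Bool := Nat.beq ((m >>> a) % 2) 1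

/-- The masks of the blocks through the point `a`. -/
@[irreducible]
def masksThrough (a : ℕ) : List ℕ :=
  baseBlocks.flatMap fun b => ((group.map fun e => mask e b).filter (hasBit · a)).dedup

/-- The masks in `l` are pairwise disjoint, and disjoint from `acc`. -/
def pairwiseDisjoint : List ℕ → ℕ → Bool
  | [], _ => true
  | m :: l, acc => Nat.beq (m &&& acc) 0 && pairwiseDisjoint l (m ||| acc)

/-- The list `l` has `d` masks, and two of them, all assumed to contain `a`, have at most one more
common point. -/
def isPackingAt (a d : ℕ) (l : List ℕ) : Bool :=
  Nat.beq l.length d && (List.range 71).all fun c => Nat.beq c a ||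
    pairwiseDisjoint ((l.filter (hasBit · c)).map (· ^^^ (1 <<< a ||| 1 <<< c))) 0

/-! ### Kernel computations -/

/-- `f` agrees with `g` on all points. -/
def agree (f g : ℕ → ℕ) : Bool := (List.range 71).all fun i => Nat.beq (f i) (g i)

lemma gens_mul_group :
    (gens.all fun s => group.all fun e => group.any fun f =>
      agree (digit f) fun i => digit s (digit e i)) = true := by
  decide +kernel

lemma gens_subset_group : (gens.all fun s => group.any fun e => Nat.beq s e) = true := by
  decide +kernel

lemma group_inv :
    (group.all fun e => group.any fun f => agree (fun i => digit f (digit e i)) id) = true := by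
  decide +kernel

lemma group_hole :
    (group.all fun e => (List.range 71).all fun i =>
      Nat.blt (digit e i) 48 == Nat.blt i 48) = true := by
  decide +kernel

lemma exists_gens_lt :
    ((List.range 71).all fun a => [0, 48, 49, 65].contains a ||
      gens.any fun s => Nat.blt (digit s a) a) = true := by decide +kernel

lemma baseBlocks_digits :
    (baseBlocks.all fun b => Nat.blt (digit b 0) (digit b 1) && Nat.blt (digit b 1) (digit b 2) &&
      Nat.blt (digit b 2) (digit b 3) && Nat.blt (digit b 1) 48) = true := by decide +kernel

lemma isPackingAt_zero : isPackingAt 0 793 (masksThrough 0) = true := by decide +kernel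

lemma isPackingAt_48 : isPackingAt 48 720 (masksThrough 48) = true := by decide +kernel

lemma isPackingAt_49 : isPackingAt 49 720 (masksThrough 49) = true := by decide +kernel

lemma isPackingAt_65 : isPackingAt 65 720 (masksThrough 65) = true := by decide +kernel

/-! ### The group -/

lemma mul_mem_group {s e : ℕ} (hs : s ∈ gens) (he : e ∈ group) :
    ∃ f ∈ group, ∀ i, act f i = act s (act e i) := by
  have h := gens_mul_group
  simp only [List.all_eq_true, List.any_eq_true, agree, List.mem_range, Nat.beq_eq] at h
  obtain ⟨f, hf, h⟩ := h s hs e he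
  exact ⟨f, hf, fun i => Fin.ext (h i i.isLt)⟩

lemma mem_group_of_mem_gens {s : ℕ} (hs : s ∈ gens) : s ∈ group := by
  have h := gens_subset_group
  simp only [List.all_eq_true, List.any_eq_true, Nat.beq_eq] at h
  obtain ⟨e, he, rfl⟩ := h s hs
  exact he

lemma act_injective {e : ℕ} (he : e ∈ group) : Function.Injective (act e) := by
  have h := group_inv
  simp only [List.all_eq_true, List.any_eq_true, agree, List.mem_range, Nat.beq_eq, id] at h
  obtain ⟨f, -, h⟩ := h e he
  exact Function.LeftInverse.injective (g := act f) fun i => Fin.ext (h i i.isLt)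

lemma act_lt_iff {e : ℕ} (he : e ∈ group) (i : Fin 71) :
    (act e i : ℕ) < 48 ↔ (i : ℕ) < 48 := by
  have h := group_hole
  simp only [List.all_eq_true, List.mem_range, beq_iff_eq] at h
  rw [← Nat.blt_eq, ← Nat.blt_eq, ← h e he i i.isLt]
  rfl

lemma exists_act_lt (a : Fin 71) :
    a ∈ ({0, 48, 49, 65} : Finset (Fin 71)) ∨ ∃ s ∈ gens, act s a < a := by
  have h := exists_gens_lt
  rw [List.all_eq_true] at h
  replace h := h a (List.mem_range.2 a.isLt)
  rw [Bool.or_eq_true, List.any_eq_true, List.contains_iff_mem] at h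
  refine h.imp (fun h => ?_) fun ⟨s, hs, h⟩ => ⟨s, hs, Nat.blt_eq.mp h⟩
  simp only [List.mem_cons, List.not_mem_nil, or_false] at h
  simp only [Finset.mem_insert, Finset.mem_singleton]
  exact h.imp Fin.ext fun h => h.imp Fin.ext fun h => h.imp Fin.ext Fin.ext

/-- Points can be reached from the four orbit representatives. -/
lemma orbit_induction {P : Fin 71 → Prop} (h0 : P 0) (h48 : P 48) (h49 : P 49) (h65 : P 65)
    (hs : ∀ s ∈ gens, ∀ a, P (act s a) → P a) (a : Fin 71) : P a := by
  induction a using WellFoundedLT.induction with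
  | ind a ih =>
    rcases exists_act_lt a with h | ⟨s, hs', hlt⟩
    · simp only [Finset.mem_insert, Finset.mem_singleton] at h
      rcases h with rfl | rfl | rfl | rfl <;> assumption
    · exact hs s hs' a (ih _ hlt)

/-! ### The blocks -/

lemma mem_blocks {B : Finset (Fin 71)} :
    B ∈ blocks ↔ ∃ e ∈ group, ∃ b ∈ baseBlocks, translate e b = B := by
  rw [blocks]
  simp only [List.mem_toFinset, List.mem_flatMap, List.mem_map]

lemma image_act_mem_blocks {s : ℕ} (hs : s ∈ gens) {B : Finset (Fin 71)} (hB : B ∈ blocks) :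
    B.image (act s) ∈ blocks := by
  obtain ⟨e, he, b, hb, rfl⟩ := mem_blocks.1 hB
  obtain ⟨f, hf, h⟩ := mul_mem_group hs he
  refine mem_blocks.2 ⟨f, hf, b, hb, ?_⟩
  simp only [translate, Finset.image_image, Function.comp_def, h]

lemma image_act_injective {s : ℕ} (hs : s ∈ gens) :
    Function.Injective fun B : Finset (Fin 71) => B.image (act s) :=
  Finset.image_injective (act_injective (mem_group_of_mem_gens hs))

lemma image_blocks {s : ℕ} (hs : s ∈ gens) :
    blocks.image (fun B => B.image (act s)) = blocks := by
  refine Finset.eq_of_subset_of_card_le ?_ ?_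
  · intro B hB
    obtain ⟨C, hC, rfl⟩ := Finset.mem_image.1 hB
    exact image_act_mem_blocks hs hC
  · exact (Finset.card_image_of_injective _ (image_act_injective hs)).ge

lemma digits_lt {b : ℕ} (hb : b ∈ baseBlocks) :
    digit b 0 < digit b 1 ∧ digit b 1 < digit b 2 ∧ digit b 2 < digit b 3 ∧ digit b 1 < 48 := by
  have h := baseBlocks_digits
  simp only [List.all_eq_true, Bool.and_eq_true, Nat.blt_eq, and_assoc] at h
  exact h b hb

lemma mem_translate {e b : ℕ} {i : Fin 71} :
    i ∈ translate e b ↔ act e (act b 0) = i ∨ act e (act b 1) = i ∨ act e (act b 2) = i ∨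
      act e (act b 3) = i := by
  simp [translate, Fin.exists_fin_succ, Fin.castLE]

lemma translate_eq (e b : ℕ) : translate e b =
    ({act b 0, act b 1, act b 2, act b 3} : Finset (Fin 71)).image (act e) := by
  ext i
  simp [mem_translate, eq_comm]

lemma card_of_mem_blocks {B : Finset (Fin 71)} (hB : B ∈ blocks) : B.card = 4 := by
  obtain ⟨e, he, b, hb, rfl⟩ := mem_blocks.1 hB
  obtain ⟨h01, h12, h23, -⟩ := digits_lt hb
  rw [translate_eq, Finset.card_image_of_injective _ (act_injective he)]
  repeat rw [Finset.card_insert_of_notMem]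
  · rw [Finset.card_singleton]
  all_goals
    have h3 : ((3 : Fin 71) : ℕ) = 3 := rfl
    simp only [Finset.mem_insert, Finset.mem_singleton, Fin.ext_iff, act, Fin.val_zero,
      Fin.val_one, Fin.val_two, h3]
    omega

/-- The hole. -/
def hole : Finset (Fin 71) := Finset.Ici 48

lemma card_inter_hole_le {B : Finset (Fin 71)} (hB : B ∈ blocks) : (B ∩ hole).card ≤ 2 := by
  obtain ⟨e, he, b, hb, rfl⟩ := mem_blocks.1 hB
  obtain ⟨h01, -, -, h1⟩ := digits_lt hb
  refine (Finset.card_le_card (t := {act e (act b 2), act e (act b 3)}) ?_).trans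
    Finset.card_le_two
  intro i hi
  obtain ⟨hi, hY⟩ := Finset.mem_inter.1 hi
  replace hY : ¬ (i : ℕ) < 48 := by
    simpa [hole, Fin.le_def] using hY
  rw [mem_translate] at hi
  simp only [Finset.mem_insert, Finset.mem_singleton]
  rcases hi with rfl | rfl | rfl | rfl
  · rw [act_lt_iff he] at hY
    exact absurd (h01.trans h1) hY
  · rw [act_lt_iff he] at hY
    exact absurd h1 hY
  · exact .inl rfl
  · exact .inr rfl

/-! ### Masks -/

lemma hasBit_eq_testBit (m a : ℕ) : hasBit m a = m.testBit a := by
  rw [Nat.testBit_eq_decide_div_mod_eq, Bool.eq_iff_iff, hasBit, Nat.beq_eq,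
    Nat.shiftRight_eq_div_pow, decide_eq_true_iff]

/-- The set of points with a given mask. -/
def ofMask (m : ℕ) : Finset (Fin 71) := {i | m.testBit i}

lemma mem_ofMask {m : ℕ} {i : Fin 71} : i ∈ ofMask m ↔ m.testBit i = true := by
  simp [ofMask]

lemma testBit_mask (e b i : ℕ) : (mask e b).testBit i = true ↔
    digit e (digit b 0) = i ∨ digit e (digit b 1) = i ∨ digit e (digit b 2) = i ∨
      digit e (digit b 3) = i := by
  simp [mask, Nat.testBit_or, Nat.shiftLeft_eq, Nat.testBit_two_pow, or_assoc]

lemma ofMask_mask (e b : ℕ) : ofMask (mask e b) = translate e b := by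
  ext i
  rw [mem_ofMask, testBit_mask, mem_translate]
  simp [Fin.ext_iff, act, digit]

lemma lt_of_testBit_mask {e b i : ℕ} (h : (mask e b).testBit i = true) : i < 71 := by
  rw [testBit_mask] at h
  rcases h with rfl | rfl | rfl | rfl <;> exact Nat.mod_lt _ (by decide)

lemma mem_masksThrough {a m : ℕ} : m ∈ masksThrough a ↔
    (∃ e ∈ group, ∃ b ∈ baseBlocks, mask e b = m) ∧ m.testBit a = true := by
  rw [masksThrough]
  simp only [List.mem_flatMap, List.mem_dedup, List.mem_filter, List.mem_map,
    hasBit_eq_testBit]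
  tauto

lemma image_ofMask_masksThrough (a : Fin 71) :
    (masksThrough a).toFinset.image ofMask = {B ∈ blocks | a ∈ B} := by
  ext B
  simp only [Finset.mem_image, List.mem_toFinset, mem_masksThrough, Finset.mem_filter, mem_blocks]
  constructor
  · rintro ⟨_, ⟨⟨e, he, b, hb, rfl⟩, ha⟩, rfl⟩
    exact ⟨⟨e, he, b, hb, (ofMask_mask e b).symm⟩, mem_ofMask.2 ha⟩
  · rintro ⟨⟨e, he, b, hb, rfl⟩, ha⟩
    rw [← ofMask_mask, mem_ofMask] at ha
    exact ⟨_, ⟨⟨e, he, b, hb, rfl⟩, ha⟩, ofMask_mask e b⟩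

lemma ofMask_injOn (a : ℕ) : Set.InjOn ofMask (masksThrough a).toFinset := by
  intro m hm m' hm' h
  simp only [Finset.mem_coe, List.mem_toFinset, mem_masksThrough] at hm hm'
  obtain ⟨⟨e, -, b, -, rfl⟩, -⟩ := hm
  obtain ⟨⟨e', -, b', -, rfl⟩, -⟩ := hm'
  refine Nat.eq_of_testBit_eq fun i => ?_
  by_cases hi : i < 71
  · have := congrArg (fun s => (⟨i, hi⟩ : Fin 71) ∈ s) h
    simpa only [mem_ofMask, eq_iff_iff, ← Bool.eq_iff_iff] using this
  · rw [Bool.eq_iff_iff]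
    exact ⟨fun h => absurd (lt_of_testBit_mask h) hi, fun h => absurd (lt_of_testBit_mask h) hi⟩

lemma pairwiseDisjoint_spec {l : List ℕ} {acc : ℕ} (h : pairwiseDisjoint l acc = true) :
    (∀ m ∈ l, m &&& acc = 0) ∧ l.Pairwise fun m m' => m' &&& m = 0 := by
  induction l generalizing acc with
  | nil => simp
  | cons m l ih =>
    simp only [pairwiseDisjoint, Bool.and_eq_true, Nat.beq_eq] at h
    obtain ⟨hl, hp⟩ := ih h.2
    simp only [Nat.and_or_distrib_left, Nat.or_eq_zero_iff] at hl
    refine ⟨?_, List.pairwise_cons.2 ⟨fun m' hm' => (hl m' hm').1, hp⟩⟩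
    simpa [h.1] using fun m' hm' => (hl m' hm').2

lemma pairwise_of_isPackingAt {a d : ℕ} {l : List ℕ} (h : isPackingAt a d l = true) {c x : ℕ}
    (hc : c < 71) (hca : c ≠ a) (hxa : x ≠ a) (hxc : x ≠ c) :
    (l.filter (Nat.testBit · c)).Pairwise fun m m' =>
      ¬ (m.testBit x = true ∧ m'.testBit x = true) := by
  simp only [isPackingAt, Bool.and_eq_true, List.all_eq_true, List.mem_range, Bool.or_eq_true,
    Nat.beq_eq, hasBit_eq_testBit] at h
  have hp := (pairwiseDisjoint_spec ((h.2 c hc).resolve_left hca)).2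
  refine (List.pairwise_map.1 hp).imp fun {m m'} hm ⟨h1, h2⟩ => ?_
  have := congrArg (Nat.testBit · x) hm
  simp [Nat.testBit_and, Nat.testBit_xor, Nat.testBit_or, Nat.shiftLeft_eq,
    h1, h2, hxa.symm, hxc.symm] at this

lemma exists_mem_ne_ne {B : Finset (Fin 71)} (hB : B ∈ blocks) (a : Fin 71) :
    ∃ c ∈ B, ∃ x ∈ B, c ≠ a ∧ x ≠ a ∧ x ≠ c := by
  have h : 2 < B.card := by rw [card_of_mem_blocks hB]; norm_num
  have h1 : 1 < (B.erase a).card := by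
    have := Finset.pred_card_le_card_erase (s := B) (a := a)
    omega
  obtain ⟨c, hc, x, hx, hne⟩ := Finset.one_lt_card.1 h1
  rw [Finset.mem_erase] at hc hx
  exact ⟨c, hc.2, x, hx.2, hc.1, hx.1, hne.symm⟩

lemma nodup_of_isPackingAt {a : Fin 71} {d : ℕ} (h : isPackingAt a d (masksThrough a) = true) :
    (masksThrough a).Nodup := by
  rw [List.nodup_iff_sublist]
  intro m hm
  have hmem : m ∈ masksThrough a := hm.subset (by simp)
  have hB : ofMask m ∈ ({B ∈ blocks | a ∈ B} : Finset _) := by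
    rw [← image_ofMask_masksThrough]
    exact Finset.mem_image_of_mem _ (List.mem_toFinset.2 hmem)
  obtain ⟨c, hc, x, hx, hca, hxa, hxc⟩ := exists_mem_ne_ne (Finset.mem_filter.1 hB).1 a
  rw [mem_ofMask] at hc hx
  have hp := (pairwise_of_isPackingAt h c.isLt (Fin.val_ne_of_ne hca) (Fin.val_ne_of_ne hxa)
    (Fin.val_ne_of_ne hxc)).sublist (hm.filter (Nat.testBit · c))
  simp [hc, hx] at hp

/-! ### Packing property and number of blocks -/

/-- No two blocks share `a` and two further points. -/
def PackingAt (a : Fin 71) : Prop :=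
  ∀ B ∈ blocks, ∀ B' ∈ blocks, ∀ c x, c ≠ a → x ≠ a → x ≠ c →
    {a, c, x} ⊆ B → {a, c, x} ⊆ B' → B = B'

lemma packingAt_of_isPackingAt {a : Fin 71} {n d : ℕ} (hn : (a : ℕ) = n)
    (h : isPackingAt n d (masksThrough n) = true) : PackingAt a := by
  subst hn
  intro B hB B' hB' c x hca hxa hxc ht ht'
  simp only [Finset.insert_subset_iff, Finset.singleton_subset_iff] at ht ht'
  have mem {B} (hB : B ∈ blocks) (ha : a ∈ B) : ∃ m ∈ masksThrough a, ofMask m = B := by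
    have : B ∈ ({B ∈ blocks | a ∈ B} : Finset _) := Finset.mem_filter.2 ⟨hB, ha⟩
    simpa [← image_ofMask_masksThrough] using this
  obtain ⟨m, hm, rfl⟩ := mem hB ht.1
  obtain ⟨m', hm', rfl⟩ := mem hB' ht'.1
  simp only [mem_ofMask] at ht ht'
  by_contra hne
  have hp := pairwise_of_isPackingAt h c.isLt (Fin.val_ne_of_ne hca) (Fin.val_ne_of_ne hxa)
    (Fin.val_ne_of_ne hxc)
  have : Std.Symm fun m m' : ℕ => ¬ (m.testBit x = true ∧ m'.testBit x = true) :=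
    ⟨fun _ _ h h' => h h'.symm⟩
  exact hp.forall (List.mem_filter.2 ⟨hm, ht.2.1⟩)
    (List.mem_filter.2 ⟨hm', ht'.2.1⟩) (fun h => hne (congrArg ofMask h)) ⟨ht.2.2, ht'.2.2⟩

lemma packingAt (a : Fin 71) : PackingAt a := by
  refine orbit_induction (packingAt_of_isPackingAt rfl isPackingAt_zero)
    (packingAt_of_isPackingAt rfl isPackingAt_48) (packingAt_of_isPackingAt rfl isPackingAt_49)
    (packingAt_of_isPackingAt rfl isPackingAt_65) (fun s hs a h B hB B' hB' c x hca hxa hxc ht ht' => ?_)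
    a
  have inj := act_injective (mem_group_of_mem_gens hs)
  refine image_act_injective hs (h _ (image_act_mem_blocks hs hB) _ (image_act_mem_blocks hs hB')
    (act s c) (act s x) (inj.ne hca) (inj.ne hxa) (inj.ne hxc) ?_ ?_)
  · simpa using Finset.image_subset_image (f := act s) ht
  · simpa using Finset.image_subset_image (f := act s) ht'

/-- The number of blocks through `a`. -/
def degree (a : Fin 71) : ℕ := {B ∈ blocks | a ∈ B}.card

lemma degree_of_isPackingAt {a : Fin 71} {n d : ℕ} (hn : (a : ℕ) = n)
    (h : isPackingAt n d (masksThrough n) = true) : degree a = d := by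
  subst hn
  rw [degree, ← image_ofMask_masksThrough, Finset.card_image_of_injOn (ofMask_injOn a),
    List.toFinset_card_of_nodup (nodup_of_isPackingAt h)]
  simp only [isPackingAt, Bool.and_eq_true, Nat.beq_eq] at h
  exact h.1

lemma degree_act {s : ℕ} (hs : s ∈ gens) (a : Fin 71) : degree (act s a) = degree a := by
  have inj := act_injective (mem_group_of_mem_gens hs)
  have : {B ∈ blocks | act s a ∈ B} =
      ({B ∈ blocks | a ∈ B} : Finset _).image fun B => B.image (act s) := by
    conv_lhs => rw [← image_blocks hs]
    rw [Finset.filter_image]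
    simp only [inj.mem_finset_image]
  rw [degree, degree, this, Finset.card_image_of_injective _ (image_act_injective hs)]

lemma degree_eq (a : Fin 71) : degree a = if (a : ℕ) < 48 then 793 else 720 := by
  refine orbit_induction (P := fun a => degree a = if (a : ℕ) < 48 then 793 else 720)
    ((degree_of_isPackingAt rfl isPackingAt_zero).trans rfl)
    ((degree_of_isPackingAt rfl isPackingAt_48).trans rfl) ((degree_of_isPackingAt rfl isPackingAt_49).trans rfl)
    ((degree_of_isPackingAt rfl isPackingAt_65).trans rfl) (fun s hs a h => ?_) a
  simpa only [degree_act hs, act_lt_iff (mem_group_of_mem_gens hs)] using h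

lemma sum_degree : ∑ a : Fin 71, (if (a : ℕ) < 48 then 793 else 720) = 54624 := by
  rw [Fin.sum_univ_eq_sum_range (fun a => if a < 48 then 793 else 720) 71]
  decide +kernel

lemma sum_card_filter_mem {α : Type*} [Fintype α] [DecidableEq α] {S : Finset (Finset α)} {k : ℕ}
    (hS : ∀ B ∈ S, B.card = k) : ∑ a, {B ∈ S | a ∈ B}.card = S.card * k := by
  have h := Finset.sum_card_bipartiteAbove_eq_sum_card_bipartiteBelow
    (s := (Finset.univ : Finset α)) (t := S) fun a B => a ∈ B
  simp only [Finset.bipartiteAbove, Finset.bipartiteBelow, Finset.filter_univ_mem] at h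
  rw [h, Finset.sum_congr rfl hS, Finset.sum_const, smul_eq_mul]

lemma card_blocks : blocks.card = 13656 := by
  have h := sum_card_filter_mem (S := blocks) fun _ => card_of_mem_blocks
  have h' : ∑ a, degree a = 54624 :=
    (Finset.sum_congr rfl fun a _ => degree_eq a).trans sum_degree
  have := h.symm.trans h'
  omega

lemma isPQS_blocks : IsPQS 71 blocks := by
  refine ⟨fun _ => card_of_mem_blocks, fun t ht => Finset.card_le_one.2 fun B hB B' hB' => ?_⟩
  obtain ⟨a, c, x, hac, hax, hcx, rfl⟩ := Finset.card_eq_three.1 ht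
  rw [Finset.mem_filter] at hB hB'
  exact packingAt a B hB.1 B' hB'.1 c x hac.symm hax.symm hcx.symm hB.2 hB'.2

end HPQS

/-- There exists an HPQS(71,23) with exactly J(71,4,4) - J(23,4,4) = 13656
blocks. -/
theorem exists_HPQS_71_23 :
    ExistsHPQS 71 23 (johnsonBound 71 - johnsonBound 23) ∧
    johnsonBound 71 - johnsonBound 23 = 13656 := by
  have hJ : johnsonBound 71 - johnsonBound 23 = 13656 := by decide
  refine ⟨⟨HPQS.blocks, HPQS.hole, HPQS.isPQS_blocks, by decide, fun t htY ht B hB htB => ?_, ?_⟩,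
    hJ⟩
  · have := Finset.card_le_card (Finset.subset_inter htB htY)
    have := HPQS.card_inter_hole_le hB
    omega
  · rw [hJ, HPQS.card_blocks]
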